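/- arXiv:0903.1472 — 5 statements merged into one kernel-verified Lean document; each statement's English description precedes it below -/
import Mathlib

section
/- Let k be a field, G a group, and Φ a normalized 3-cocycle on G valued in kˣ. Then the function Φ̃ satisfies the identity Φ̃(f,g,h)·Φ̃(e,fg,h) = Φ̃(e,f,ghg⁻¹)·Φ̃(ef,g,h) for all e, f, g, h ∈ G. (This is the compatibility identity which makes the conjugate action on the right-coinvariants of a Majid bimodule a Φ-twisted projective representation, and which makes the induced action in Lemma 3.2 well defined.) -/
/-- The twisted function `Φ̃` associated to a 3-cocycle `Φ` on a group `G`: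
`Φ̃(e,f,g) = Φ(e,f,g)·Φ(ef,f⁻¹,e⁻¹)·Φ(e,fg,f⁻¹) / (Φ(efg,f⁻¹,e⁻¹)·Φ(e,f,f⁻¹))`. -/
def tildePhi {k : Type*} [Field k] {G : Type*} [Group G]
    (Φ : G → G → G → kˣ) (e f g : G) : kˣ :=
  Φ e f g * Φ (e * f) f⁻¹ e⁻¹ * Φ e (f * g) f⁻¹ /
    (Φ (e * f * g) f⁻¹ e⁻¹ * Φ e f f⁻¹)

theorem tildePhi_compat {k : Type*} [Field k] {G : Type*} [Group G]
    (Φ : G → G → G → kˣ)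
    (hcoc : ∀ e f g h : G,
      Φ e f g * Φ e (f * g) h * Φ f g h = Φ (e * f) g h * Φ e f (g * h))
    (hnorm : ∀ e f : G, Φ 1 e f = 1 ∧ Φ e 1 f = 1 ∧ Φ e f 1 = 1) :
    ∀ e f g h : G,
      tildePhi Φ f g h * tildePhi Φ e (f * g) h =
        tildePhi Φ e f (g * h * g⁻¹) * tildePhi Φ (e * f) g h := by
  intro e f g h
  have h₁ := congrArg Additive.ofMul (hcoc (e * f) g g⁻¹ f⁻¹)
  have h₂ := congrArg Additive.ofMul (hcoc (e * f * g) g⁻¹ f⁻¹ e⁻¹)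
  have h₃ := congrArg Additive.ofMul (hcoc e (f * g * h) g⁻¹ f⁻¹)
  have h₄ := congrArg Additive.ofMul (hcoc e f g (g⁻¹ * f⁻¹))
  have h₅ := congrArg Additive.ofMul (hcoc (e * f * g * h) g⁻¹ f⁻¹ e⁻¹)
  have h₆ := congrArg Additive.ofMul (hcoc e f (g * h) g⁻¹)
  have h₇ := congrArg Additive.ofMul (hcoc f g g⁻¹ f⁻¹)
  have h₈ := congrArg Additive.ofMul (hcoc e f g h)
  apply Additive.ofMul.injective
  simp only [tildePhi, ofMul_mul, ofMul_div, mul_assoc, mul_inv_rev,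
    mul_inv_cancel, mul_inv_cancel_left, mul_one,
    (hnorm _ _).1, (hnorm _ _).2.1, (hnorm _ _).2.2] at *
  linear_combination (norm := abel)
    h₁ + h₂ - h₃ - h₄ - h₅ + h₆ - h₇ + h₈
end

section
/- (Lemma 3.1) Let k be a field, G a group, Φ a normalized 3-cocycle on G valued in kˣ, and g ∈ G. Then the function Φ̃_g is a normalized 2-cocycle on the centralizer Z_g: Φ̃_g(ε,f) = Φ̃_g(f,ε) = 1 for all f ∈ Z_g, and Φ̃_g(e,f)·Φ̃_g(ef,h) = Φ̃_g(f,h)·Φ̃_g(e,fh) for all e, f, h ∈ Z_g. -/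
/-- The additive form of the centralizer 2-cocycle identity. -/
theorem additive_tilde_cocycle {G A : Type*} [Group G] [AddCommGroup A] (φ : G → G → G → A)
    (hcoc : ∀ e f g h : G,
      φ e f g + φ e (f * g) h + φ f g h = φ (e * f) g h + φ e f (g * h))
    (hnorm₁ : ∀ e f : G, φ 1 e f = 0) (hnorm₂ : ∀ e f : G, φ e 1 f = 0)
    (hnorm₃ : ∀ e f : G, φ e f 1 = 0)
    {e f h g : G} (he : e * g = g * e) (hf : f * g = g * f) (hh : h * g = g * h) :
    let ψ : G → G → A := fun a b ↦
      φ a b g + φ (a * b) b⁻¹ a⁻¹ + φ a (b * g) b⁻¹ -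
        (φ (a * b * g) b⁻¹ a⁻¹ + φ a b b⁻¹)
    ψ e f + ψ (e * f) h = ψ f h + ψ e (f * h) := by
  intro ψ
  have he' (x : G) : e * (g * x) = g * (e * x) := by rw [← mul_assoc, he, mul_assoc]
  have hf' (x : G) : f * (g * x) = g * (f * x) := by rw [← mul_assoc, hf, mul_assoc]
  have hh' (x : G) : h * (g * x) = g * (h * x) := by rw [← mul_assoc, hh, mul_assoc]
  have c₁ := hcoc (e * f) h h⁻¹ f⁻¹
  have c₂ := hcoc e (f * h) h⁻¹ f⁻¹
  have c₃ := hcoc h h⁻¹ f⁻¹ e⁻¹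
  have c₄ := hcoc e (f * h) h⁻¹ (f⁻¹ * e⁻¹)
  have c₅ := hcoc (e * f) h (h⁻¹ * f⁻¹) e⁻¹
  have c₆ := hcoc e f h h⁻¹
  have c₇ := hcoc f h h⁻¹ (f⁻¹ * e⁻¹)
  have c₈ := hcoc e f (h * g) h⁻¹
  have c₉ := hcoc e (f * h * g) h⁻¹ f⁻¹
  have c₁₀ := hcoc e f h g
  have c₁₁ := hcoc (e * f * h * g) h⁻¹ f⁻¹ e⁻¹
  have c₁₂ := hcoc e f h (h⁻¹ * f⁻¹ * e⁻¹)
  simp only [ψ, mul_assoc, mul_inv_rev, mul_inv_cancel_left,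
    mul_inv_cancel, mul_one, he, he', hf, hf', hh, hh',
    hnorm₁, hnorm₂, hnorm₃] at *
  linear_combination (norm := module)
    c₁ - c₂ - c₃ - c₄ + c₅ + (2 : ℤ) • c₆ - c₇ - c₈ + c₉ - c₁₀ + c₁₁ - c₁₂

/-- Lemma 3.1: for any `g ∈ G`, the function `Φ̃_g(e,f) = Φ̃(e,f,g)` is a normalized
2-cocycle on the centralizer `Z_g = {x : x * g = g * x}`. -/
theorem tildePhi_is_two_cocycle_on_centralizer {k : Type*} [Field k] {G : Type*} [Group G]
    (Φ : G → G → G → kˣ)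
    (hcoc : ∀ e f g h : G,
      Φ e f g * Φ e (f * g) h * Φ f g h = Φ (e * f) g h * Φ e f (g * h))
    (hnorm : ∀ e f : G, Φ 1 e f = 1 ∧ Φ e 1 f = 1 ∧ Φ e f 1 = 1)
    (g : G) :
    (∀ f : G, f * g = g * f →
      tildePhi Φ 1 f g = 1 ∧ tildePhi Φ f 1 g = 1) ∧
    (∀ e f h : G, e * g = g * e → f * g = g * f → h * g = g * h →
      tildePhi Φ e f g * tildePhi Φ (e * f) h g =
        tildePhi Φ f h g * tildePhi Φ e (f * h) g) := by
  refine ⟨fun f _ ↦ ?_, fun e f h he hf hh ↦ ?_⟩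
  · simp [tildePhi, fun a b ↦ (hnorm a b).1, fun a b ↦ (hnorm a b).2.1,
      fun a b ↦ (hnorm a b).2.2]
  · exact additive_tilde_cocycle (A := Additive kˣ) (fun a b c ↦ Additive.ofMul (Φ a b c))
      hcoc (fun a b ↦ (hnorm a b).1) (fun a b ↦ (hnorm a b).2.1)
      (fun a b ↦ (hnorm a b).2.2) he hf hh
end

section
/- Let k be a field, G a group, Φ a normalized 3-cocycle on G valued in kˣ, F a gauge transformation on G, and g ∈ G. Then for all e, f ∈ Z_g one has (Φ_F)̃_g(e,f)·μ^F_g(ef) = Φ̃_g(e,f)·μ^F_g(e)·μ^F_g(f). In particular, the 2-cocycles (Φ_F)̃_g and Φ̃_g on the centralizer Z_g are cohomologous, with explicit coboundary given by μ^F_g. (This is the cocycle-level identity underlying equation (4.8) and Theorem 4.3.) -/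
/-- The differential of a 2-cochain `F` on a group `G`:
`∂F(e,f,g) = F(e,f)·F(ef,g) / (F(e,fg)·F(f,g))`. -/
def diffF {k : Type*} [Field k] {G : Type*} [Group G]
    (F : G → G → kˣ) (e f g : G) : kˣ :=
  F e f * F (e * f) g / (F e (f * g) * F f g)

/-- `μ^F_g(f) = F(f,f⁻¹) / (F(f,g)·F(fg,f⁻¹))`. -/
def muF {k : Type*} [Field k] {G : Type*} [Group G]
    (F : G → G → kˣ) (g f : G) : kˣ :=
  F f f⁻¹ / (F f g * F (f * g) f⁻¹)

theorem tildePhi_mul {k : Type*} [Field k] {G : Type*} [Group G]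
    (Φ Ψ : G → G → G → kˣ) (e f g : G) :
    tildePhi (fun a b c => Φ a b c * Ψ a b c) e f g =
      tildePhi Φ e f g * tildePhi Ψ e f g := by
  apply Units.ext
  simp only [tildePhi, Units.val_mul, Units.val_div_eq_div_val]
  field_simp

theorem tildePhi_diffF_mul_muF {k : Type*} [Field k] {G : Type*} [Group G]
    {F : G → G → kˣ} (hF : ∀ a : G, F a 1 = 1) {e f g : G} (hf : f * g = g * f) :
    tildePhi (diffF F) e f g * muF F g (e * f) = muF F g e * muF F g f := by
  have hfg : f * g * f⁻¹ = g := by rw [hf, mul_inv_cancel_right]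
  have hefg : e * f * g * f⁻¹ = e * g := by rw [mul_assoc e, mul_assoc e, hfg]
  apply Units.ext
  simp only [tildePhi, diffF, muF, hfg, hefg, mul_inv_cancel_right, mul_inv_cancel, hF,
    mul_inv_rev, Units.val_mul, Units.val_div_eq_div_val, Units.val_one]
  field_simp
  rw [mul_assoc]

/-- For a normalized 3-cocycle `Φ`, a gauge transformation `F` and `g ∈ G`, the
2-cocycles `(Φ_F)̃_g` and `Φ̃_g` on the centralizer `Z_g` are cohomologous with
explicit coboundary `μ^F_g`:
`(Φ_F)̃_g(e,f)·μ^F_g(ef) = Φ̃_g(e,f)·μ^F_g(e)·μ^F_g(f)` for all `e, f ∈ Z_g`. -/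
theorem tildePhi_gauge_coboundary {k : Type*} [Field k] {G : Type*} [Group G]
    (Φ : G → G → G → kˣ)
    (hcoc : ∀ e f g h : G,
      Φ e f g * Φ e (f * g) h * Φ f g h = Φ (e * f) g h * Φ e f (g * h))
    (hnorm : ∀ e f : G, Φ 1 e f = 1 ∧ Φ e 1 f = 1 ∧ Φ e f 1 = 1)
    (F : G → G → kˣ)
    (hF : ∀ g : G, F g 1 = 1 ∧ F 1 g = 1)
    (g : G) :
    ∀ e f : G, e * g = g * e → f * g = g * f →
      tildePhi (fun a b c => Φ a b c * diffF F a b c) e f g * muF F g (e * f) =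
        tildePhi Φ e f g * muF F g e * muF F g f := by
  intro e f _ hf
  rw [tildePhi_mul, mul_assoc, tildePhi_diffF_mul_muF (fun a => (hF a).1) hf, mul_assoc]
end

section
/- Let k be a field and G a group. If Φ and Φ' are normalized 3-cocycles on G valued in kˣ that are cohomologous in the sense that Φ' = Φ·∂F for some gauge transformation F on G, then for every g ∈ G the normalized 2-cocycles Φ̃_g and Φ̃'_g on the centralizer Z_g are cohomologous: there exists a function μ : Z_g → kˣ with μ(ε) = 1 such that Φ̃'_g(e,f) = Φ̃_g(e,f)·μ(e)·μ(f)/μ(ef) for all e, f ∈ Z_g. -/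
/-- If the normalized 3-cocycles `Φ` and `Φ'` on `G` are cohomologous, i.e.
`Φ' = Φ·∂F` for a gauge transformation `F` on `G`, then for every `g ∈ G` the
2-cocycles `Φ̃_g` and `Φ̃'_g` on the centralizer `Z_g` are cohomologous. -/
theorem tildePhi_cohomologous_of_cohomologous {k : Type*} [Field k] {G : Type*} [Group G]
    (Φ Φ' : G → G → G → kˣ)
    (hcoc : ∀ e f g h : G,
      Φ e f g * Φ e (f * g) h * Φ f g h = Φ (e * f) g h * Φ e f (g * h))
    (hnorm : ∀ e f : G, Φ 1 e f = 1 ∧ Φ e 1 f = 1 ∧ Φ e f 1 = 1)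
    (hcoc' : ∀ e f g h : G,
      Φ' e f g * Φ' e (f * g) h * Φ' f g h = Φ' (e * f) g h * Φ' e f (g * h))
    (hnorm' : ∀ e f : G, Φ' 1 e f = 1 ∧ Φ' e 1 f = 1 ∧ Φ' e f 1 = 1)
    (hFsome : ∃ F : G → G → kˣ, (∀ g : G, F g 1 = 1 ∧ F 1 g = 1) ∧
      ∀ e f g : G, Φ' e f g = Φ e f g * diffF F e f g)
    (g : G) :
    ∃ μ : G → kˣ, μ 1 = 1 ∧
      ∀ e f : G, e * g = g * e → f * g = g * f →
        tildePhi Φ' e f g = tildePhi Φ e f g * μ e * μ f / μ (e * f) := by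
  obtain ⟨F, hF, hΦ⟩ := hFsome
  refine ⟨fun x => F x x⁻¹ / (F x g * F (x * g) x⁻¹), by simp [hF], fun e f he hf => ?_⟩
  have conj_f : f * g * f⁻¹ = g := by rw [hf, mul_inv_cancel_right]
  have cancel_f : e * f * g * f⁻¹ = e * g := by rw [mul_assoc e, mul_assoc e, conj_f]
  simp only [tildePhi, hΦ, diffF, conj_f, cancel_f, mul_inv_cancel_right, mul_inv_cancel,
    (hF e).1, mul_inv_rev]
  apply Units.ext
  push_cast
  field_simp
  rw [mul_assoc]
end

section
/- Let k = ℂ and ℤ₂ = {ε, g} the cyclic group of order 2. For every gauge transformation F on ℤ₂ and every x ∈ ℤ₂, one has μ^F_g(x) = 1. Consequently, the two one-dimensional projective representations ρ₊, ρ₋ : ℤ₂ → ℂˣ with ρ₊(ε) = ρ₋(ε) = 1, ρ₊(g) = i, ρ₋(g) = -i (which both satisfy ρ(g)² = -1) are not F-uniformly projectively equivalent for any gauge transformation F: there is no gauge transformation F on ℤ₂ such that ρ₋(x) = μ^F_g(x)·ρ₊(x) for all x ∈ ℤ₂. (This is the fact that the simple modules S(+i) and S(-i) are not gauge equivalent,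 which yields that the Majid algebras M₊(8) and M₋(8) are not gauge equivalent.) -/
/-- The imaginary unit `i` as a unit of `ℂ`. -/
def iUnit : ℂˣ :=
  ⟨Complex.I, -Complex.I, by simp [Complex.I_mul_I], by simp [Complex.I_mul_I]⟩

theorem muF_one {k : Type*} [Field k] {G : Type*} [Group G] {F : G → G → kˣ}
    (hF : ∀ x : G, F x 1 = 1 ∧ F 1 x = 1) (g : G) : muF F g 1 = 1 := by
  simp [muF, hF]

theorem muF_self_of_mul_self_eq_one {k : Type*} [Field k] {G : Type*} [Group G]
    {F : G → G → kˣ} (hF : ∀ x : G, F x 1 = 1 ∧ F 1 x = 1) {g : G} (hg : g * g = 1) :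
    muF F g g = 1 := by
  have hinv : g⁻¹ = g := inv_eq_of_mul_eq_one_left hg
  simp [muF, hinv, hg, hF]

theorem iUnit_inv_ne : iUnit⁻¹ ≠ iUnit := by
  intro h
  have h' := congrArg (fun u : ℂˣ => (u : ℂ).im) h
  norm_num [iUnit] at h'

/-- Over `ℂ` and `ℤ₂ = {ε, g}`: for every gauge transformation `F` on `ℤ₂` one has
`μ^F_g ≡ 1`; consequently the one-dimensional projective representations `ρ₊`
(with `ρ₊(g) = i`) and `ρ₋` (with `ρ₋(g) = -i`) are not `F`-uniformly projectively
equivalent for any gauge transformation `F`. -/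
theorem S_plus_i_not_gauge_equivalent_S_minus_i :
    let G := Multiplicative (ZMod 2)
    let g : G := Multiplicative.ofAdd (1 : ZMod 2)
    let ρp : G → ℂˣ := fun x => if x = g then iUnit else 1
    let ρm : G → ℂˣ := fun x => if x = g then iUnit⁻¹ else 1
    (∀ F : G → G → ℂˣ, (∀ x : G, F x 1 = 1 ∧ F 1 x = 1) →
      ∀ x : G, muF F g x = 1) ∧
    ¬ ∃ F : G → G → ℂˣ, (∀ x : G, F x 1 = 1 ∧ F 1 x = 1) ∧
        ∀ x : G, ρm x = muF F g x * ρp x := by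
  intro G g ρp ρm
  have hmu : ∀ F : G → G → ℂˣ, (∀ x : G, F x 1 = 1 ∧ F 1 x = 1) →
      ∀ x : G, muF F g x = 1 := by
    intro F hF x
    have hx : x = 1 ∨ x = g := by
      revert x
      decide
    rcases hx with rfl | rfl
    · exact muF_one hF g
    · exact muF_self_of_mul_self_eq_one hF (by decide)
  refine ⟨hmu, ?_⟩
  rintro ⟨F, hF, h⟩
  have hg := h g
  rw [hmu F hF g, one_mul] at hg
  simp only [ρm, ρp, if_true] at hg
  exact iUnit_inv_ne hg
end
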